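/- Fix probability vectors p = (p_w, p_d, p_ℓ) and q = (q_w, q_d, q_ℓ), and assume p_w < p_ℓ and the defensive style is safe, i.e. q_d = 1. Then the optimal gain converges: g*_N → max( 0, 2·p_w/p_ℓ − 1 ) as N → ∞. -/

import Mathlib

noncomputable section

open Filter Topology Finset

/-- The sign of an integer score, as a real number (`sgn 0 = 0`). -/
def sgn (x : ℤ) : ℝ := if 0 < x then 1 else if x < 0 then -1 else 0

/-- Expected sign of the score after one more game played with win/draw/loss
probabilities `w, d, l`, starting from score `x`. -/
def stepVal (w d l : ℝ) (x : ℤ) : ℝ := w * sgn (x + 1) + d * sgn x + l * sgn (x - 1)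

/-- Bellman value function with `k` games remaining: `bellman p q k x = V_{N-k}^N(x)`.
With no game remaining the value is the sign of the score; otherwise Player 1 picks the
better of the offensive style `(pw, pd, pl)` and the defensive style `(qw, qd, ql)`. -/
def bellman (pw pd pl qw qd ql : ℝ) : ℕ → ℤ → ℝ
  | 0, x => sgn x
  | k + 1, x =>
      max
        (pw * bellman pw pd pl qw qd ql k (x + 1) + pd * bellman pw pd pl qw qd ql k x +
          pl * bellman pw pd pl qw qd ql k (x - 1))
        (qw * bellman pw pd pl qw qd ql k (x + 1) + qd * bellman pw pd pl qw qd ql k x +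
          ql * bellman pw pd pl qw qd ql k (x - 1))

/-- Optimal gain over `N` games: `g*_N = V_0^N(0)`. -/
def gOpt (pw pd pl qw qd ql : ℝ) (N : ℕ) : ℝ := bellman pw pd pl qw qd ql N 0

/-- The two playing styles of Player 1. -/
inductive Style
  | offense
  | defense
deriving DecidableEq

/-- Selects the probability attached to a style: `a` for offense, `b` for defense. -/
def styleP (a b : ℝ) : Style → ℝ
  | .offense => a
  | .defense => b

/-- Probability mass function of the score process `X_n` under the policy `π`
(playing `π n x` at round `n+1` when the current score is `x`), started at `X_0 = 0`. -/
def polDist (pw pd pl qw qd ql : ℝ) (π : ℕ → ℤ → Style) : ℕ → ℤ → ℝ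
  | 0, x => if x = 0 then 1 else 0
  | n + 1, x =>
      polDist pw pd pl qw qd ql π n (x - 1) * styleP pw qw (π n (x - 1)) +
      polDist pw pd pl qw qd ql π n x * styleP pd qd (π n x) +
      polDist pw pd pl qw qd ql π n (x + 1) * styleP pl ql (π n (x + 1))

/-- Gain of policy `π` over `n` games: `g_n^π = E[sign (X_n)]`. -/
def gPol (pw pd pl qw qd ql : ℝ) (π : ℕ → ℤ → Style) (n : ℕ) : ℝ :=
  ∑' x : ℤ, polDist pw pd pl qw qd ql π n x * sgn x

/-- Probability mass function of the pair (score, switched-to-defense flag) under the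
catenaccio policy: play offense until the score first reaches `+1`, then defense forever. -/
def catDist (pw pd pl qw qd ql : ℝ) : ℕ → ℤ → Bool → ℝ
  | 0, x, b => if x = 0 ∧ b = false then 1 else 0
  | n + 1, x, true =>
      catDist pw pd pl qw qd ql n (x - 1) true * qw +
      catDist pw pd pl qw qd ql n x true * qd +
      catDist pw pd pl qw qd ql n (x + 1) true * ql +
      (if x = 1 then
        catDist pw pd pl qw qd ql n 0 false * pw +
        catDist pw pd pl qw qd ql n 1 false * pd +
        catDist pw pd pl qw qd ql n 2 false * pl
       else 0)
  | n + 1, x, false =>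
      if x = 1 then 0
      else
        catDist pw pd pl qw qd ql n (x - 1) false * pw +
        catDist pw pd pl qw qd ql n x false * pd +
        catDist pw pd pl qw qd ql n (x + 1) false * pl

/-- Gain of the catenaccio policy over `N` games: `g_N^(cat) = E[sign (X_N)]`. -/
def gCat (pw pd pl qw qd ql : ℝ) (N : ℕ) : ℝ :=
  ∑' x : ℤ,
    (catDist pw pd pl qw qd ql N x false + catDist pw pd pl qw qd ql N x true) * sgn x

/-- Gain of the catenaccio+ policy over `N` games: play catenaccio, except that if the
score after `N - 1` games is `0`, the last game is played with the better of the two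
styles (offense if `pw - pl > qw - ql`, defense otherwise). -/
def gCatPlus (pw pd pl qw qd ql : ℝ) : ℕ → ℝ
  | 0 => 0
  | N + 1 =>
      ∑' x : ℤ,
        (catDist pw pd pl qw qd ql N x false *
            (if x = 0 then (if pw - pl > qw - ql then pw - pl else qw - ql)
             else stepVal pw pd pl x) +
          catDist pw pd pl qw qd ql N x true *
            (if x = 0 then (if pw - pl > qw - ql then pw - pl else qw - ql)
             else stepVal qw qd ql x))

/-- Probability mass function of the lazy random walk with i.i.d. increments (+1 with
probability `qw`, 0 with probability `qd`, −1 with probability `ql`), started at `0`. -/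
def walkDist (qw qd ql : ℝ) : ℕ → ℤ → ℝ
  | 0, x => if x = 0 then 1 else 0
  | n + 1, x =>
      walkDist qw qd ql n (x - 1) * qw + walkDist qw qd ql n x * qd +
        walkDist qw qd ql n (x + 1) * ql

/-- Fixed-style gain over `N` games for the walk with step law `(qw, qd, ql)`. -/
def gFixed (qw qd ql : ℝ) (N : ℕ) : ℝ := ∑' x : ℤ, walkDist qw qd ql N x * sgn x

/-- Probability mass function of the lazy random walk with step law `(pw, pd, pl)`,
started at `0` and absorbed (stopped) at the level `+1`.  In particular
`stoppedDist pw pd pl n 1` is the probability that the walk reaches `+1` by time `n`. -/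
def stoppedDist (pw pd pl : ℝ) : ℕ → ℤ → ℝ
  | 0, x => if x = 0 then 1 else 0
  | n + 1, x =>
      if x = 1 then
        stoppedDist pw pd pl n 1 + stoppedDist pw pd pl n 0 * pw +
          stoppedDist pw pd pl n 2 * pl
      else
        (if x - 1 = 1 then 0 else stoppedDist pw pd pl n (x - 1) * pw) +
          stoppedDist pw pd pl n x * pd +
          (if x + 1 = 1 then 0 else stoppedDist pw pd pl n (x + 1) * pl)

/-- The limiting value of playing offense until the score first reaches `1`, when the game is
worth `v` at score `0` and `r` is the probability that the walk ever climbs one level. -/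
def climbVal (r v : ℝ) (x : ℤ) : ℝ :=
  if 0 < x then 1 else (1 + v) * r ^ (-x).toNat - 1

lemma climbVal_of_pos (r v : ℝ) {x : ℤ} (hx : 0 < x) : climbVal r v x = 1 := if_pos hx

lemma climbVal_neg_natCast (r v : ℝ) (m : ℕ) :
    climbVal r v (-(m : ℤ)) = (1 + v) * r ^ m - 1 := by
  simp [climbVal]

lemma sgn_le_climbVal {r v : ℝ} (hr : 0 ≤ r) (hv : 0 ≤ v) (x : ℤ) : sgn x ≤ climbVal r v x := by
  rcases lt_trichotomy x 0 with hx | rfl | hx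
  · have : 0 ≤ (1 + v) * r ^ (-x).toNat := by positivity
    simp only [sgn, climbVal, hx, hx.not_gt, if_true, if_false]
    linarith
  · simpa [sgn, climbVal] using hv
  · simp [sgn, climbVal, hx]

lemma climbVal_le_one {r v : ℝ} (hr : 0 ≤ r) (hr1 : r ≤ 1) (hv : 0 ≤ v) (hv1 : v ≤ 1) (x : ℤ) :
    climbVal r v x ≤ 1 := by
  unfold climbVal
  split_ifs
  · exact le_rfl
  · have h : r ^ (-x).toNat ≤ 1 := pow_le_one₀ hr hr1
    have : (1 + v) * r ^ (-x).toNat ≤ (1 + v) * 1 := by gcongr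
    linarith

/-- `climbVal` is superharmonic for the offensive step. -/
lemma climbVal_superharmonic {w d l r v : ℝ} (hw : 0 ≤ w) (hd : 0 ≤ d) (hl : 0 ≤ l)
    (hsum : w + d + l = 1) (hr : 0 ≤ r) (hr1 : r ≤ 1) (hwr : w = l * r)
    (hv : 0 ≤ v) (hv1 : v ≤ 1) (hv2 : 2 * r - 1 ≤ v) (x : ℤ) :
    w * climbVal r v (x + 1) + d * climbVal r v x + l * climbVal r v (x - 1) ≤
      climbVal r v x := by
  rcases lt_or_ge 0 x with hx | hx
  · rw [climbVal_of_pos r v hx, climbVal_of_pos r v (by lia : 0 < x + 1)]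
    nlinarith [climbVal_le_one hr hr1 hv hv1 (x - 1)]
  obtain ⟨m, rfl⟩ : ∃ m : ℕ, x = -(m : ℤ) := ⟨(-x).toNat, by lia⟩
  have hdn : -(m : ℤ) - 1 = -((m + 1 : ℕ) : ℤ) := by push_cast; ring
  have hd' : d = 1 - w - l := by linarith
  rw [hdn, climbVal_neg_natCast, climbVal_neg_natCast]
  cases m with
  | zero =>
    rw [climbVal_of_pos r v (by simp)]
    subst hd' hwr
    simp only [pow_zero, zero_add, pow_one]
    nlinarith [mul_le_mul_of_nonneg_left hv2 hl]
  | succ m =>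
    have hup : -((m + 1 : ℕ) : ℤ) + 1 = -(m : ℤ) := by push_cast; ring
    rw [hup, climbVal_neg_natCast]
    subst hd' hwr
    apply le_of_eq
    ring

lemma bellman_le_climbVal {w d l r v : ℝ} (hw : 0 ≤ w) (hd : 0 ≤ d) (hl : 0 ≤ l)
    (hsum : w + d + l = 1) (hr : 0 ≤ r) (hr1 : r ≤ 1) (hwr : w = l * r)
    (hv : 0 ≤ v) (hv1 : v ≤ 1) (hv2 : 2 * r - 1 ≤ v) (k : ℕ) (x : ℤ) :
    bellman w d l 0 1 0 k x ≤ climbVal r v x := by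
  induction k generalizing x with
  | zero => exact sgn_le_climbVal hr hv x
  | succ k ih =>
    rw [bellman]
    refine max_le (le_trans ?_
      (climbVal_superharmonic hw hd hl hsum hr hr1 hwr hv hv1 hv2 x)) (by simpa using ih x)
    gcongr <;> exact ih _

lemma bellman_safe_monotone (w d l : ℝ) (x : ℤ) :
    Monotone fun k => bellman w d l 0 1 0 k x :=
  monotone_nat_of_le_succ fun k => by
    conv_rhs => rw [bellman]
    exact le_max_of_le_right (by simp)

/-- A nonnegative function on `{…, -1, 0, 1}` that is superharmonic below `1` for a walk whose
upward-to-downward ratio is `r < 1` has at `0` at least `r` times its value at `1`. -/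
lemma mul_le_of_superharmonic {w d l r : ℝ} (hl : 0 < l) (hsum : w + d + l = 1) (hr : 0 ≤ r)
    (hr1 : r < 1) (hwr : w = l * r) {W : ℤ → ℝ} (hW : ∀ x, 0 ≤ W x)
    (hsup : ∀ x, w * W (x + 1) + d * W x + l * W (x - 1) ≤ W x) : r * W 1 ≤ W 0 := by
  have hstep (x : ℤ) : r * (W (x + 1) - W x) ≤ W x - W (x - 1) := by
    have hd' : d = 1 - w - l := by linarith
    have := hsup x
    subst hd' hwr
    refine le_of_mul_le_mul_left ?_ hl
    linarith
  have key (m : ℕ) : r ^ m * (W 1 - W 0) ≤ W (-(m : ℤ) + 1) - W (-(m : ℤ)) ∧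
      (W 1 - W 0) * (1 - r ^ (m + 1)) ≤ (1 - r) * (W 1 - W (-(m : ℤ))) := by
    induction m with
    | zero => simp [mul_comm]
    | succ m ih =>
      have hup : -((m + 1 : ℕ) : ℤ) + 1 = -(m : ℤ) := by push_cast; ring
      have hdn : -((m + 1 : ℕ) : ℤ) = -(m : ℤ) - 1 := by push_cast; ring
      have h1 : r ^ (m + 1) * (W 1 - W 0) ≤ W (-(m : ℤ)) - W (-(m : ℤ) - 1) := by
        refine le_trans ?_ (hstep (-(m : ℤ)))
        rw [pow_succ', mul_assoc]
        exact mul_le_mul_of_nonneg_left ih.1 hr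
      rw [hup, hdn]
      refine ⟨h1, ?_⟩
      have h2 := mul_le_mul_of_nonneg_left h1 (sub_nonneg.2 hr1.le)
      rw [pow_succ r (m + 1)]
      linarith [ih.2]
  have hlim : Tendsto (fun m : ℕ => (W 1 - W 0) * (1 - r ^ (m + 1))) atTop
      (𝓝 ((W 1 - W 0) * (1 - 0))) :=
    (((tendsto_pow_atTop_nhds_zero_of_lt_one hr hr1).comp (tendsto_add_atTop_nat 1)).const_sub
      1).const_mul _
  have := le_of_tendsto' hlim fun m => (key m).2.trans
    (mul_le_mul_of_nonneg_left (sub_le_self (W 1) (hW _)) (sub_nonneg.2 hr1.le))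
  linarith

/-- If `pw < pl` and the defensive style is safe (`qd = 1`), then the
optimal gain converges: `g*_N → max (0, 2 pw / pl − 1)` as `N → ∞`. -/
theorem gOpt_tendsto_of_safe_defense
    (pw pd pl qw qd ql : ℝ)
    (hpw : 0 ≤ pw) (hpd : 0 ≤ pd) (hpl : 0 ≤ pl) (hp : pw + pd + pl = 1)
    (hqw : 0 ≤ qw) (hqd : 0 ≤ qd) (hql : 0 ≤ ql) (hq : qw + qd + ql = 1)
    (hlosep : pw < pl) (hsafe : qd = 1) :
    Tendsto (fun N : ℕ => gOpt pw pd pl qw qd ql N) atTop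
      (𝓝 (max 0 (2 * pw / pl - 1))) := by
  obtain rfl : qw = 0 := by linarith
  obtain rfl : ql = 0 := by linarith
  subst hsafe
  have hl : 0 < pl := hpw.trans_lt hlosep
  obtain ⟨r, hr⟩ : ∃ r, r = pw / pl := ⟨_, rfl⟩
  have hwr : pw = pl * r := by rw [hr]; field_simp
  have hr0 : 0 ≤ r := hr ▸ div_nonneg hpw hpl
  have hr1 : r < 1 := hr ▸ (div_lt_one hl).2 hlosep
  rw [mul_div_assoc, ← hr]
  have hle (k : ℕ) (x : ℤ) : bellman pw pd pl 0 1 0 k x ≤ climbVal r (max 0 (2 * r - 1)) x :=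
    bellman_le_climbVal hpw hpd hpl hp hr0 hr1.le hwr (le_max_left _ _)
      (max_le zero_le_one (by linarith)) (le_max_right _ _) k x
  have hex (x : ℤ) : ∃ V, Tendsto (fun k => bellman pw pd pl 0 1 0 k x) atTop (𝓝 V) :=
    ⟨_, tendsto_atTop_ciSup (bellman_safe_monotone pw pd pl x)
      ⟨_, Set.forall_mem_range.2 fun k => hle k x⟩⟩
  choose V hV using hex
  have hsgn (x : ℤ) : sgn x ≤ V x := (bellman_safe_monotone pw pd pl x).ge_of_tendsto (hV x) 0
  have hV0 : 0 ≤ V 0 := by simpa [sgn] using hsgn 0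
  have hV1 : 1 ≤ V 1 := by simpa [sgn] using hsgn 1
  have hVneg (x : ℤ) : 0 ≤ V x + 1 := by
    have : -1 ≤ sgn x := by unfold sgn; split_ifs <;> norm_num
    linarith [hsgn x]
  have hsup (x : ℤ) : pw * V (x + 1) + pd * V x + pl * V (x - 1) ≤ V x := by
    refine le_of_tendsto_of_tendsto' ((((hV (x + 1)).const_mul pw).add ((hV x).const_mul pd)).add
      ((hV (x - 1)).const_mul pl)) ((tendsto_add_atTop_iff_nat 1).2 (hV x)) fun k => ?_
    exact le_max_left _ _
  have hclimb : r * (V 1 + 1) ≤ V 0 + 1 :=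
    mul_le_of_superharmonic (W := fun x => V x + 1) hl hp hr0 hr1 hwr hVneg fun x => by
      linarith [hsup x]
  have hupper : V 0 ≤ max 0 (2 * r - 1) :=
    le_of_tendsto' (hV 0) fun k => (hle k 0).trans_eq (by simp [climbVal])
  have hlower : max 0 (2 * r - 1) ≤ V 0 :=
    max_le hV0 (by nlinarith)
  rw [hlower.antisymm hupper]
  exact hV 0
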